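/- The only Fibonacci numbers which are concatenations (in base 10) of a Lucas number followed by a Fibonacci number are 13 and 21. -/

import Mathlib

def lucas : ℕ → ℕ
  | 0 => 2
  | 1 => 1
  | n + 2 => lucas (n + 1) + lucas n

theorem lucas_add_fib (m : ℕ) : lucas m + Nat.fib m = 2 * Nat.fib (m + 1) := by
  induction m using Nat.twoStepInduction with
  | zero => decide
  | one => decide
  | more m h₀ h₁ =>
    have e₁ := Nat.fib_add_two (n := m)
    have e₂ := Nat.fib_add_two (n := m + 1)
    simp only [lucas]
    grind

theorem lucas_pos (m : ℕ) : 0 < lucas m := by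
  have h := lucas_add_fib m
  have h₁ := Nat.fib_le_fib_succ (n := m)
  have h₂ : 0 < Nat.fib (m + 1) := Nat.fib_pos.2 (by omega)
  omega

theorem two_mul_fib_lt_lucas {m : ℕ} (hm : 4 ≤ m) : 2 * Nat.fib m < lucas m := by
  obtain ⟨j, rfl⟩ := Nat.exists_eq_add_of_le' hm
  have h := lucas_add_fib (j + 4)
  have e₁ := Nat.fib_add_two (n := j + 1)
  have e₂ := Nat.fib_add_two (n := j + 2)
  have e₃ := Nat.fib_add_two (n := j + 3)
  have h₂ : 0 < Nat.fib (j + 1) := Nat.fib_pos.2 (by omega)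
  grind

theorem intFib_add_add_intFib_sub (a : ℤ) (m : ℕ) :
    Int.fib (a + m) + (-1) ^ m * Int.fib (a - m) = lucas m * Int.fib a := by
  induction m using Nat.twoStepInduction with
  | zero => simp [lucas]; ring
  | one =>
    have h := Int.fib_add_two (a - 1)
    rw [show a - 1 + 2 = a + 1 by ring, show a - 1 + 1 = a by ring] at h
    simp [lucas, h]
  | more m h₀ h₁ =>
    have e₁ := Int.fib_add_two (a + m)
    have e₂ := Int.fib_add_two (a - m - 2)
    rw [show a - m - 2 + 2 = a - m by ring, show a - m - 2 + 1 = a - m - 1 by ring] at e₂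
    push_cast [lucas] at h₀ h₁ ⊢
    rw [show a + (m + 2 : ℤ) = a + m + 2 by ring, show a - (m + 2 : ℤ) = a - m - 2 by ring, e₁]
    rw [show a + (m + 1 : ℤ) = a + m + 1 by ring, show a - (m + 1 : ℤ) = a - m - 1 by ring] at h₁
    rw [e₂] at h₀
    linear_combination h₀ + h₁

theorem abs_intFib (r : ℤ) : |Int.fib r| = Nat.fib r.natAbs := by
  obtain ⟨n, rfl | rfl⟩ := r.eq_nat_or_neg
  · simp
  · rw [Int.fib_neg_natCast]
    simp [abs_mul]

theorem abs_intFib_le {r : ℤ} {m : ℕ} (h : |r| ≤ m) : |Int.fib r| ≤ Nat.fib m := by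
  rw [abs_intFib]
  exact_mod_cast Nat.fib_mono (by rw [abs_le] at h; omega)

theorem fib_eq_fib {a b : ℕ} (h : Nat.fib a = Nat.fib b) : a = b ∨ a + b = 3 := by
  wlog hab : a ≤ b generalizing a b
  · have := this h.symm (by omega)
    omega
  rcases lt_or_ge a 2 with ha | ha
  · have hb : b ≤ 2 := by
      by_contra! hb
      have := (Nat.fib_lt_fib le_rfl).2 hb
      have := Nat.fib_mono ha.le
      omega
    interval_cases b <;> interval_cases a <;> simp_all
  · exact .inl (Nat.fib_strictMonoOn.injOn ha (ha.trans hab) h)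

/-- Shifting the index by `2 * m` changes Fibonacci numbers by a fixed sign modulo `lucas m`. -/
theorem exists_intFib_modEq_lucas (m : ℕ) (q : ℕ) :
    ∃ δ : ℤ, (δ = 1 ∨ δ = -1) ∧
      ∀ x : ℤ, (lucas m : ℤ) ∣ Int.fib (x + 2 * m * q) - δ * Int.fib x := by
  induction q with
  | zero => exact ⟨1, .inl rfl, fun x ↦ by simp⟩
  | succ q ih =>
    obtain ⟨δ, hδ, h⟩ := ih
    refine ⟨δ * -(-1) ^ m, ?_, fun x ↦ ?_⟩
    · rcases neg_one_pow_eq_or ℤ m with hs | hs <;> rcases hδ with rfl | rfl <;> rw [hs] <;> simp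
    · have h₁ := intFib_add_add_intFib_sub (x + m) m
      have h₂ := h (x + 2 * m)
      rw [show x + (m : ℤ) - m = x by ring, show x + (m : ℤ) + m = x + 2 * m by ring] at h₁
      rw [show x + 2 * (m : ℤ) + 2 * m * q = x + 2 * m * (q + 1 : ℕ) by push_cast; ring] at h₂
      have h₃ := (Dvd.intro _ h₁.symm).mul_left δ
      refine Eq.subst (motive := ((lucas m : ℤ) ∣ ·)) ?_ (dvd_add h₂ h₃)
      ring

theorem natAbs_eq_of_lucas_dvd {m : ℕ} (hm : 4 ≤ m) {a b σ : ℤ} (hσ : σ = 1 ∨ σ = -1)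
    (ha : |a| ≤ m) (hb : |b| ≤ m) (h : (lucas m : ℤ) ∣ Int.fib a - σ * Int.fib b) :
    a.natAbs = b.natAbs ∨ a.natAbs + b.natAbs = 3 := by
  have hlt : (2 * Nat.fib m : ℤ) < lucas m := by exact_mod_cast two_mul_fib_lt_lucas hm
  have ha' := abs_intFib_le ha
  have hb' := abs_intFib_le hb
  have h₀ : Int.fib a - σ * Int.fib b = 0 := by
    refine Int.eq_zero_of_abs_lt_dvd h ?_
    rw [abs_le] at ha' hb'
    rw [abs_lt]
    rcases hσ with rfl | rfl <;> constructor <;> linarith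
  apply fib_eq_fib
  zify
  rw [← abs_intFib, ← abs_intFib, sub_eq_zero.1 h₀, abs_mul]
  rcases hσ with rfl | rfl <;> simp

/-- If `lucas m` divides a difference of Fibonacci numbers whose indices differ by the odd
number `m + t`, then `m` is small compared with `t`. -/
theorem le_of_lucas_dvd_sub {m k t : ℕ} (hodd : Odd (m + t))
    (h : (lucas m : ℤ) ∣ Nat.fib (m + k + t) - Nat.fib k) : m ≤ t + 3 := by
  by_contra! hlt
  have hm : 4 ≤ m := by omega
  obtain ⟨r, q, hr, hr₁, hr₂⟩ : ∃ (r : ℤ) (q : ℕ), (k : ℤ) = r + 2 * m * q ∧ -m ≤ r ∧ r ≤ m := by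
    have hk := Nat.mod_add_div k (2 * m)
    have hk' := Nat.mod_lt k (show 0 < 2 * m by omega)
    generalize k % (2 * m) = s at hk hk'
    generalize k / (2 * m) = q at hk
    zify at hk
    rcases le_or_gt s m with hle | hgt
    · exact ⟨s, q, by linarith, by omega, by omega⟩
    · exact ⟨s - 2 * m, q + 1, by push_cast; linarith, by omega, by omega⟩
  obtain ⟨δ, hδ, hmod⟩ := exists_intFib_modEq_lucas m q
  have h₁ : (lucas m : ℤ) ∣ Int.fib (r + m + t) - 1 * Int.fib r := by
    have h₂ := hmod r
    have h₃ := hmod (r + m + t)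
    rw [← hr, Int.fib_natCast] at h₂
    rw [show r + m + t + 2 * m * q = ((m + k + t : ℕ) : ℤ) by push_cast; rw [hr]; ring,
      Int.fib_natCast] at h₃
    have h₄ := (dvd_add (dvd_sub h h₃) h₂).mul_left δ
    have h₅ : δ * δ = 1 := by rcases hδ with rfl | rfl <;> rfl
    refine Eq.subst (motive := ((lucas m : ℤ) ∣ ·)) ?_ h₄
    linear_combination (Int.fib (r + m + t) - Int.fib r) * h₅
  obtain ⟨c, hc⟩ := hodd
  rcases le_or_gt (-t : ℤ) r with hrt | hrt
  · have h₂ := Dvd.intro _ (intFib_add_add_intFib_sub (r + t) m).symm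
    rw [show r + t + (m : ℤ) = r + m + t by ring] at h₂
    have h₃ : (lucas m : ℤ) ∣ Int.fib r - -(-1) ^ m * Int.fib (r + t - m) := by
      refine Eq.subst (motive := ((lucas m : ℤ) ∣ ·)) ?_ (dvd_sub h₂ h₁)
      ring
    have h₄ := natAbs_eq_of_lucas_dvd hm
      (by rcases neg_one_pow_eq_or ℤ m with h | h <;> rw [h] <;> simp)
      (abs_le.2 ⟨hr₁, hr₂⟩) (abs_le.2 ⟨by omega, by omega⟩) h₃
    omega
  · have h₄ := natAbs_eq_of_lucas_dvd hm (.inl rfl)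
      (abs_le.2 ⟨by omega, by omega⟩) (abs_le.2 ⟨hr₁, hr₂⟩) h₁
    omega

theorem fib_add_mod_of_period {N P : ℕ} (h₀ : Nat.fib P % N = 0)
    (h₁ : Nat.fib (P + 1) % N = 1 % N) (n : ℕ) : Nat.fib (n + P) % N = Nat.fib n % N := by
  change Nat.fib (P + 1) ≡ 1 [MOD N] at h₁
  change Nat.fib P ≡ 0 [MOD N] at h₀
  change Nat.fib (n + P) ≡ Nat.fib n [MOD N]
  rcases n with _ | n
  · simpa using h₀
  · rw [show n + 1 + P = n + P + 1 by ring, Nat.fib_add]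
    simpa using (h₀.mul_left (Nat.fib n)).add (h₁.mul_left (Nat.fib (n + 1)))

theorem fib_mod_of_period {N P : ℕ} (h₀ : Nat.fib P % N = 0)
    (h₁ : Nat.fib (P + 1) % N = 1 % N) (n : ℕ) : Nat.fib n % N = Nat.fib (n % P) % N :=
  (Function.Periodic.map_mod_nat (f := fun n ↦ Nat.fib n % N)
    (fib_add_mod_of_period h₀ h₁) n).symm

theorem ten_pow_ne_fib {d : ℕ} (hd : d ≠ 0) (j : ℕ) : 10 ^ d ≠ Nat.fib j := by
  intro h
  have h₁ : Nat.fib 15 ∣ Nat.fib j := by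
    apply Nat.fib_dvd
    have h₂ := fib_mod_of_period (N := 10) (P := 60) (by decide +kernel) (by decide +kernel) j
    rw [← h, Nat.mod_eq_zero_of_dvd (dvd_pow_self 10 hd)] at h₂
    have h₃ : ∀ i < 60, 0 = Nat.fib i % 10 → 15 ∣ i := by decide +kernel
    have := h₃ _ (Nat.mod_lt j (by norm_num)) h₂
    omega
  have h₂ : 61 ∣ 10 ^ d := h ▸ (show 61 ∣ Nat.fib 15 by decide +kernel).trans h₁
  have h₃ := (show Nat.Prime 61 by norm_num).dvd_of_dvd_pow h₂
  norm_num at h₃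

theorem not_eight_dvd_lucas (n : ℕ) : ¬ 8 ∣ lucas n := by
  have h := lucas_add_fib n
  have h₁ := fib_mod_of_period (N := 8) (P := 12) (by decide +kernel) (by decide +kernel) n
  have h₂ := fib_add_mod_of_period (N := 8) (P := 12) (by decide +kernel) (by decide +kernel)
  have h₃ := (Function.Periodic.map_mod_nat (f := fun n ↦ Nat.fib (n + 1) % 8)
    (fun n ↦ by simpa [Nat.add_right_comm] using h₂ (n + 1)) n)
  have h₄ : ∀ i < 12, Nat.fib i % 8 ≠ (2 * (Nat.fib (i + 1) % 8)) % 8 := by decide +kernel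
  have h₅ := h₄ _ (Nat.mod_lt n (by norm_num))
  rw [← h₁] at h₅
  omega

theorem fib_two_mul_eq_mul_lucas (b : ℕ) : Nat.fib (2 * b) = Nat.fib b * lucas b := by
  rw [Nat.fib_two_mul, ← lucas_add_fib, Nat.add_sub_cancel]

theorem two_pow_dvd_of_two_pow_dvd_fib (i a : ℕ) (h : 2 ^ (i + 3) ∣ Nat.fib a) :
    2 ^ (i + 1) ∣ a := by
  induction i generalizing a with
  | zero =>
    have h₁ := fib_mod_of_period (N := 8) (P := 12) (by decide +kernel) (by decide +kernel) a
    rw [Nat.mod_eq_zero_of_dvd (by simpa using h)] at h₁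
    have h₂ : ∀ i < 12, 0 = Nat.fib i % 8 → 2 ∣ i := by decide +kernel
    have := h₂ _ (Nat.mod_lt a (by norm_num)) h₁
    omega
  | succ i ih =>
    have h₀ : 16 ∣ Nat.fib a := (pow_dvd_pow 2 (show 4 ≤ i + 1 + 3 by omega)).trans h
    have h₁ := fib_mod_of_period (N := 16) (P := 24) (by decide +kernel) (by decide +kernel) a
    rw [Nat.mod_eq_zero_of_dvd h₀] at h₁
    have h₂ : ∀ i < 24, 0 = Nat.fib i % 16 → 12 ∣ i := by decide +kernel
    have h₃ := h₂ _ (Nat.mod_lt a (by norm_num)) h₁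
    obtain ⟨b, rfl⟩ : ∃ b, a = 2 * (6 * b) := ⟨a / 12, by omega⟩
    have hb : Nat.fib (6 * b) % 4 = 0 :=
      Nat.mod_eq_zero_of_dvd <| (show 4 ∣ Nat.fib 6 by decide).trans (Nat.fib_dvd _ _ ⟨b, rfl⟩)
    have hb₁ := Nat.fib_coprime_fib_succ (6 * b)
    have hodd : Nat.fib (6 * b + 1) % 2 = 1 := by
      by_contra hne
      have := Nat.dvd_gcd (show 2 ∣ Nat.fib (6 * b) by omega)
        (show 2 ∣ Nat.fib (6 * b + 1) by omega)
      rw [hb₁] at this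
      omega
    have hL := lucas_add_fib (6 * b)
    obtain ⟨c, hc, hc'⟩ : ∃ c, lucas (6 * b) = 2 * c ∧ c % 2 = 1 :=
      ⟨lucas (6 * b) / 2, by omega, by omega⟩
    rw [fib_two_mul_eq_mul_lucas, hc, show i + 1 + 3 = i + 3 + 1 by ring, pow_succ',
      mul_left_comm] at h
    have h₄ := Nat.dvd_of_mul_dvd_mul_left two_pos h
    have h₅ : Nat.Coprime (2 ^ (i + 3)) c :=
      Nat.Coprime.pow_left _ ((Nat.coprime_two_left).2 (Nat.odd_iff.2 hc'))
    rw [pow_succ']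
    exact Nat.mul_dvd_mul_left 2 (ih _ (h₅.dvd_of_dvd_mul_right h₄))

/-- A difference of two Fibonacci numbers whose indices have the same parity factors as a
Fibonacci number times a Lucas number. -/
theorem exists_fib_add_two_mul_eq (k h : ℕ) :
    ∃ a b, a ≤ h + k ∧ (0 < h → 0 < a) ∧
      Nat.fib (k + 2 * h) = Nat.fib a * lucas b + Nat.fib k := by
  rcases h.even_or_odd with hh | hh
  · refine ⟨h, h + k, by omega, id, ?_⟩
    have h₁ := intFib_add_add_intFib_sub h (h + k)
    rw [show (h : ℤ) + (h + k : ℕ) = (k + 2 * h : ℕ) by push_cast; ring,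
      show (h : ℤ) - (h + k : ℕ) = -(k : ℕ) by push_cast; ring, Int.fib_neg_natCast,
      Int.fib_natCast, Int.fib_natCast, pow_add, pow_succ, hh.neg_one_pow] at h₁
    zify
    have h₂ : ((-1) ^ k * (-1) ^ k : ℤ) = 1 := by rw [← mul_pow]; simp
    linear_combination h₁ + (Nat.fib k : ℤ) * h₂
  · refine ⟨h + k, h, le_rfl, by omega, ?_⟩
    have h₁ := intFib_add_add_intFib_sub (h + k : ℕ) h
    rw [show ((h + k : ℕ) : ℤ) + h = (k + 2 * h : ℕ) by push_cast; ring,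
      show ((h + k : ℕ) : ℤ) - h = (k : ℕ) by push_cast; ring,
      Int.fib_natCast, Int.fib_natCast, Int.fib_natCast, hh.neg_one_pow] at h₁
    zify
    linear_combination h₁

theorem ten_pow_le_fib (d : ℕ) :
    10 ^ d ≤ Nat.fib (5 * d + 2) ∧ 3 * 10 ^ d ≤ 2 * Nat.fib (5 * d + 3) := by
  induction d with
  | zero => decide
  | succ d ih =>
    have e₁ := Nat.fib_add_two (n := 5 * d + 2)
    have e₂ := Nat.fib_add_two (n := 5 * d + 3)
    have e₃ := Nat.fib_add_two (n := 5 * d + 4)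
    have e₄ := Nat.fib_add_two (n := 5 * d + 5)
    have e₅ := Nat.fib_add_two (n := 5 * d + 6)
    rw [show 5 * (d + 1) + 2 = 5 * d + 7 by ring, show 5 * (d + 1) + 3 = 5 * d + 8 by ring]
    simp only [add_assoc, Nat.reduceAdd] at *
    rw [pow_succ]
    omega

theorem le_mul_add_one_of_fib_lt {d k : ℕ} (h : Nat.fib k < 10 ^ d) : k ≤ 5 * d + 1 := by
  by_contra! hk
  have := Nat.fib_mono (show 5 * d + 2 ≤ k by omega)
  have := (ten_pow_le_fib d).1
  omega

theorem exists_index_eq {n m k d : ℕ} (hk : 1 ≤ k) (h₁ : Nat.fib k < 10 ^ d)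
    (h₂ : 10 ^ d ≤ 10 * Nat.fib k) (h : Nat.fib n = 10 ^ d * lucas m + Nat.fib k) :
    ∃ t < 8, n = m + k + t := by
  have hF : 0 < Nat.fib k := Nat.fib_pos.2 hk
  have hL := lucas_add_fib m
  obtain ⟨k, rfl⟩ := Nat.exists_eq_add_of_le' hk
  have hlow : m + (k + 1) ≤ n := by
    by_contra! hn
    have h₃ := Nat.fib_mono (show n ≤ m + k by omega)
    have h₄ : Nat.fib (m + k) ≤ Nat.fib (m + 1) * Nat.fib (k + 1) := by
      rcases m with _ | m
      · simpa using Nat.fib_le_fib_succ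
      · rw [show m + 1 + k = m + k + 1 by ring, Nat.fib_add, Nat.fib_add_two (n := m), add_mul]
        exact Nat.add_le_add_right (Nat.mul_le_mul_left _ Nat.fib_le_fib_succ) _
    have h₅ : Nat.fib (m + 1) ≤ lucas m := by
      have := Nat.fib_le_fib_succ (n := m)
      omega
    have h₆ : Nat.fib (m + 1) * Nat.fib (k + 1) ≤ 10 ^ d * lucas m := by
      rw [mul_comm]
      gcongr
    omega
  have hup : n ≤ m + (k + 1) + 7 := by
    by_contra! hn
    have h₃ := Nat.fib_mono (show m + 8 + k + 1 ≤ n by omega)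
    rw [Nat.fib_add] at h₃
    have h₄ : Nat.fib n ≤ (10 * lucas m + 1) * Nat.fib (k + 1) := by
      rw [h]
      nlinarith [Nat.mul_le_mul_right (lucas m) h₂]
    have e₁ := Nat.fib_add m 8
    have e₂ : Nat.fib 8 = 21 := by decide
    have e₃ : Nat.fib 9 = 34 := by decide
    have h₅ : 0 < Nat.fib (m + 1) := Nat.fib_pos.2 (by omega)
    rw [show m + 8 + 1 = m + 9 by ring, e₂, e₃] at e₁
    rw [show m + 8 + 1 = m + 9 by ring, e₁] at h₃
    have h₆ : 10 * lucas m + 1 < Nat.fib m * 21 + Nat.fib (m + 1) * 34 := by omega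
    nlinarith [Nat.mul_lt_mul_of_pos_right h₆ hF]
  exact ⟨n - (m + (k + 1)), by omega, by omega⟩

/-- Either `m` is at most slightly larger than `k`, or `10 ^ d` is a Fibonacci number. -/
theorem lt_add_of_fib_eq {m k d t : ℕ} (hd : d ≠ 0) (hm : 4 ≤ m)
    (h : Nat.fib (m + k + t) = 10 ^ d * lucas m + Nat.fib k) : m < k + t := by
  by_contra! hmk
  have hid := intFib_add_add_intFib_sub (k + t : ℕ) m
  rw [show ((k + t : ℕ) : ℤ) + m = (m + k + t : ℕ) by push_cast; ring, Int.fib_natCast,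
    Int.fib_natCast] at hid
  zify at h
  have hlt : (2 * Nat.fib m : ℤ) < lucas m := by exact_mod_cast two_mul_fib_lt_lucas hm
  have h₁ : |Int.fib ((k + t : ℕ) - m)| ≤ Nat.fib m :=
    abs_intFib_le (abs_le.2 ⟨by omega, by omega⟩)
  have h₂ : (Nat.fib k : ℤ) ≤ Nat.fib m := by exact_mod_cast Nat.fib_mono (by omega)
  have h₃ : (-1) ^ m * Int.fib ((k + t : ℕ) - m) + Nat.fib k = 0 := by
    refine Int.eq_zero_of_abs_lt_dvd (m := lucas m) ⟨Nat.fib (k + t) - 10 ^ d, ?_⟩ ?_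
    · linear_combination hid - h
    · refine (abs_add_le _ _).trans_lt ?_
      rw [abs_mul, abs_pow, abs_neg, abs_one, one_pow, one_mul, Nat.abs_cast]
      linarith
  refine ten_pow_ne_fib hd (k + t) ?_
  have hL : (lucas m : ℤ) ≠ 0 := by exact_mod_cast (lucas_pos m).ne'
  zify
  refine mul_left_cancel₀ hL ?_
  linear_combination hid - h - h₃

theorem le_ten_of_even {m k d t : ℕ} (ht : t < 8) (hd : d ≠ 0) (heven : Even (m + t))
    (h₁ : Nat.fib k < 10 ^ d) (h : Nat.fib (m + k + t) = 10 ^ d * lucas m + Nat.fib k) :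
    d ≤ 10 := by
  by_contra! hd'
  obtain ⟨c, hc⟩ := heven
  have hpos : 0 < 10 ^ d * lucas m := Nat.mul_pos (by positivity) (lucas_pos m)
  obtain ⟨a, b, hab, ha, heq⟩ := exists_fib_add_two_mul_eq k c
  rw [show k + 2 * c = m + k + t by omega, h, Nat.add_right_cancel_iff] at heq
  have hc₀ : 0 < c := by
    by_contra! hc₀
    rw [show m + k + t = k by omega] at h
    omega
  obtain ⟨i, rfl⟩ := Nat.exists_eq_add_of_le' (show 5 ≤ d by omega)
  have h₂ : 2 ^ (i + 3 + 2) ∣ Nat.fib a * lucas b :=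
    heq ▸ (pow_dvd_pow_of_dvd (show 2 ∣ 10 by norm_num) _).mul_right _
  have h₃ : 2 ^ (i + 3) ∣ Nat.fib a := by
    obtain ⟨u, v, hu, hv⟩ : ∃ u v, lucas b = 2 ^ u * v ∧ ¬ 2 ∣ v := by
      obtain ⟨u, v, hv, hu⟩ := Nat.exists_eq_pow_mul_and_not_dvd (lucas_pos b).ne' 2 (by norm_num)
      exact ⟨u, v, hu, hv⟩
    have hu₂ : u ≤ 2 := by
      by_contra! hu₂
      exact not_eight_dvd_lucas b (hu ▸ (pow_dvd_pow 2 hu₂).mul_right v)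
    rw [hu, ← mul_assoc] at h₂
    have h₄ := (Nat.Coprime.pow_left _
      ((Nat.prime_two.coprime_iff_not_dvd).2 hv)).dvd_of_dvd_mul_right h₂
    rw [pow_add] at h₄
    exact Nat.dvd_of_mul_dvd_mul_right (by norm_num)
      (h₄.trans (Nat.mul_dvd_mul_left _ (pow_dvd_pow 2 hu₂)))
  have h₅ := Nat.le_of_dvd (ha hc₀) (two_pow_dvd_of_two_pow_dvd_fib i a h₃)
  have h₆ := le_mul_add_one_of_fib_lt h₁
  have h₇ : m < 4 ∨ m < k + t := by
    by_contra! hm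
    exact hm.2.not_gt (lt_add_of_fib_eq hd hm.1 h)
  have h₈ : ∀ j, 16 * (j + 6) < 2 ^ (j + 6 + 1) := by
    intro j
    induction j with
    | zero => norm_num
    | succ j ih => rw [show j + 1 + 6 + 1 = j + 6 + 1 + 1 by ring, pow_succ 2 (j + 6 + 1)]; omega
  obtain ⟨j, rfl⟩ := Nat.exists_eq_add_of_le' (show 6 ≤ i by omega)
  have := h₈ j
  omega

theorem mod_obstruction : ∀ m ∈ List.range 11, ∀ t ∈ List.range 8, (m + t) % 2 = 1 →
    (∀ k ∈ List.range 24,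
      (Nat.fib (m + k + t) + 64 * Nat.fib m) % 144 ≠
        (64 * (2 * Nat.fib (m + 1)) + Nat.fib k) % 144) ∨
    (∀ k ∈ List.range 60, ∀ x ∈ [100, 120],
      (Nat.fib (m + k + t) + x * Nat.fib m) % 220 ≠
        (x * (2 * Nat.fib (m + 1)) + Nat.fib k) % 220) := by
  decide +kernel

theorem ten_pow_add_four_mod_144 (d : ℕ) : 10 ^ (d + 4) % 144 = 64 := by
  induction d with
  | zero => norm_num
  | succ d ih => rw [show d + 1 + 4 = d + 4 + 1 by ring, pow_succ]; omega

theorem ten_pow_add_four_mod_220 (d : ℕ) : 10 ^ (d + 4) % 220 ∈ [100, 120] := by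
  suffices 10 ^ (d + 4) % 220 = 100 ∨ 10 ^ (d + 4) % 220 = 120 by simpa
  induction d with
  | zero => norm_num
  | succ d ih => rw [show d + 1 + 4 = d + 4 + 1 by ring, pow_succ]; omega

theorem modEq_of_fib_eq {N P m k t d x : ℕ} (h₀ : Nat.fib P % N = 0)
    (h₁ : Nat.fib (P + 1) % N = 1 % N) (hx : 10 ^ d % N = x)
    (h : Nat.fib (m + k + t) = 10 ^ d * lucas m + Nat.fib k) :
    (Nat.fib (m + k % P + t) + x * Nat.fib m) % N =
      (x * (2 * Nat.fib (m + 1)) + Nat.fib (k % P)) % N := by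
  have h₂ : Nat.fib (m + k % P + t) ≡ Nat.fib (m + k + t) [MOD N] := by
    change _ % _ = _ % _
    rw [fib_mod_of_period h₀ h₁, fib_mod_of_period h₀ h₁ (m + k + t)]
    congr 2
    exact ((Nat.mod_modEq k P).add_left m).add_right t
  have h₃ : Nat.fib (k % P) ≡ Nat.fib k [MOD N] := (fib_mod_of_period h₀ h₁ k).symm
  have h₄ : x ≡ 10 ^ d [MOD N] := hx ▸ Nat.mod_modEq _ _
  refine (h₂.add (h₄.mul_right _)).trans (.trans ?_ ((h₄.mul_right _).add h₃).symm)
  rw [h, ← lucas_add_fib]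
  exact congrArg (· % N) (by ring)

theorem le_three_of_odd {m k d t : ℕ} (hm : m ≤ 10) (ht : t < 8) (hodd : Odd (m + t))
    (h : Nat.fib (m + k + t) = 10 ^ d * lucas m + Nat.fib k) : d ≤ 3 := by
  by_contra! hd
  obtain ⟨d, rfl⟩ := Nat.exists_eq_add_of_le' hd
  rcases mod_obstruction m (List.mem_range.2 (by omega)) t (List.mem_range.2 ht)
    (Nat.odd_iff.1 hodd) with h₁ | h₁
  · exact h₁ _ (List.mem_range.2 (Nat.mod_lt k (by norm_num)))
      (modEq_of_fib_eq (by decide +kernel) (by decide +kernel) (ten_pow_add_four_mod_144 d) h)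
  · exact h₁ _ (List.mem_range.2 (Nat.mod_lt k (by norm_num))) _ (ten_pow_add_four_mod_220 d)
      (modEq_of_fib_eq (by decide +kernel) (by decide +kernel) rfl h)

theorem fib_eq_of_bounded : ∀ d ∈ List.range 11, ∀ k ∈ List.range 52,
    Nat.fib k < 10 ^ d → 10 ^ d ≤ 10 * Nat.fib k →
    ∀ m ∈ List.range 60, ∀ t ∈ List.range 8,
      Nat.fib (m + k + t) + 10 ^ d * Nat.fib m =
        10 ^ d * (2 * Nat.fib (m + 1)) + Nat.fib k →
      Nat.fib (m + k + t) = 13 ∨ Nat.fib (m + k + t) = 21 := by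
  decide +kernel

theorem fib_eq_concat_lucas_fib :
    {x : ℕ | ∃ n m k : ℕ, 1 ≤ k ∧
        x = Nat.fib n ∧
        Nat.fib n = 10 ^ (Nat.log 10 (Nat.fib k) + 1) * lucas m + Nat.fib k} =
      ({13, 21} : Set ℕ) := by
  ext x
  simp only [Set.mem_ofPred_eq, Set.mem_insert_iff, Set.mem_singleton_iff]
  constructor
  · rintro ⟨n, m, k, hk, rfl, h⟩
    have hF : Nat.fib k ≠ 0 := (Nat.fib_pos.2 hk).ne'
    have h₁ := Nat.lt_pow_succ_log_self (b := 10) (by norm_num) (Nat.fib k)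
    have h₂ : 10 ^ (Nat.log 10 (Nat.fib k) + 1) ≤ 10 * Nat.fib k := by
      rw [pow_succ']
      exact Nat.mul_le_mul_left 10 (Nat.pow_log_le_self 10 hF)
    have hd : Nat.log 10 (Nat.fib k) + 1 ≠ 0 := by omega
    rw [Nat.succ_eq_add_one] at h₁
    generalize Nat.log 10 (Nat.fib k) + 1 = d at *
    obtain ⟨t, ht, rfl⟩ := exists_index_eq hk h₁ h₂ h
    have hmk : m < 4 ∨ m < k + t := by
      by_contra! hm
      exact hm.2.not_gt (lt_add_of_fib_eq hd hm.1 h)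
    have hkd := le_mul_add_one_of_fib_lt h₁
    have hd₁₀ : d ≤ 10 := by
      rcases (m + t).even_or_odd with he | ho
      · exact le_ten_of_even ht hd he h₁ h
      · have hm := le_of_lucas_dvd_sub (k := k) ho ⟨10 ^ d, by rw [h]; push_cast; ring⟩
        have := le_three_of_odd (by omega) ht ho h
        omega
    refine fib_eq_of_bounded d (List.mem_range.2 (by omega)) k (List.mem_range.2 (by omega)) h₁ h₂
      m (List.mem_range.2 (by omega)) t (List.mem_range.2 ht) ?_
    rw [h, ← lucas_add_fib]
    ring
  · rintro (rfl | rfl)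
    · exact ⟨7, 1, 4, by norm_num, by decide, by simp [lucas]; decide⟩
    · exact ⟨8, 0, 1, by norm_num, by decide, by simp [lucas]; decide⟩
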